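/- Let 𝒜 be a graded algebra over ℂ satisfying conditions (5.2) and (5.3). Then for every n = 2, 3, …, Ker M^{(n+1)} = (Ker M^{(n)}) ⊗ 𝒜1 + 𝒜1 ⊗ Ker M^{(n)}, where M^{(n)} : 𝒜1^{⊗n} → 𝒜_n is the n-fold multiplication map and the two summands are regarded as subspaces of 𝒜1^{⊗(n+1)}. -/

import Mathlib

open TensorProduct

section Graded

variable (A : ℕ → Type*) [∀ t, AddCommGroup (A t)] [∀ t, Module ℂ (A t)]
variable (mul : ∀ s t : ℕ, A s →ₗ[ℂ] A t →ₗ[ℂ] A (s + t))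

/-- The multiplication map `M_{s,t} : 𝒜_s ⊗ 𝒜_t → 𝒜_{s+t}`. -/
noncomputable def M2 (s t : ℕ) : (A s ⊗[ℂ] A t) →ₗ[ℂ] A (s + t) :=
  TensorProduct.lift (mul s t)

/-- The multiplication map `M_{r,s,t} : (𝒜_r ⊗ 𝒜_s) ⊗ 𝒜_t → 𝒜_{r+s+t}`. -/
noncomputable def M3 (r s t : ℕ) : ((A r ⊗[ℂ] A s) ⊗[ℂ] A t) →ₗ[ℂ] A (r + s + t) :=
  (M2 A mul (r + s) t).comp (TensorProduct.map (M2 A mul r s) LinearMap.id)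

/-- Associativity of the graded multiplication. -/
def GradedAssoc : Prop :=
  ∀ (r s t : ℕ) (x : A r) (y : A s) (z : A t),
    HEq (mul (r + s) t (mul r s x y) z) (mul r (s + t) x (mul s t y z))

/-- Condition (5.2): `Ker M_{r,s,t} = (Ker M_{r,s}) ⊗ 𝒜_t + 𝒜_r ⊗ (Ker M_{s,t})`
for all positive `r`, `s`, `t`. -/
def Cond52 : Prop :=
  ∀ r s t : ℕ, 1 ≤ r → 1 ≤ s → 1 ≤ t →
    LinearMap.ker (M3 A mul r s t) =
      LinearMap.range (TensorProduct.mapIncl (LinearMap.ker (M2 A mul r s))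
          (⊤ : Submodule ℂ (A t))) ⊔
        Submodule.map (TensorProduct.assoc ℂ (A r) (A s) (A t)).symm.toLinearMap
          (LinearMap.range (TensorProduct.mapIncl (⊤ : Submodule ℂ (A r))
            (LinearMap.ker (M2 A mul s t))))

/-- Condition (5.3): `M_{s,t}` is surjective for all positive `s`, `t`. -/
def Cond53 : Prop :=
  ∀ s t : ℕ, 1 ≤ s → 1 ≤ t → Function.Surjective (M2 A mul s t)

/-- The canonical equivalence `⨂[ℂ]^1 M ≃ M`. -/
noncomputable def pow1Equiv (M : Type*) [AddCommGroup M] [Module ℂ M] :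
    (⨂[ℂ]^1 M) ≃ₗ[ℂ] M :=
  PiTensorProduct.subsingletonEquiv 0

/-- The `n`-fold multiplication map `M^{(n)} : 𝒜_1^{⊗n} → 𝒜_n`; here `MPow A mul n`
is `M^{(n+1)}`, with domain the `(n+1)`-st tensor power of `𝒜_1`. -/
noncomputable def MPow : ∀ n : ℕ, (⨂[ℂ]^(n + 1) (A 1)) →ₗ[ℂ] A (n + 1)
  | 0 => (pow1Equiv (A 1)).toLinearMap
  | (n + 1) =>
    (M2 A mul (n + 1) 1).comp
      ((TensorProduct.map (MPow n) (pow1Equiv (A 1)).toLinearMap).comp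
        (TensorPower.mulEquiv (R := ℂ) (M := A 1) (n := n + 1) (m := 1)).symm.toLinearMap)

end Graded

/-- The identification `(⨂^n M) ⊗ M ≃ ⨂^(n+1) M`. -/
noncomputable def rightMulEquiv (M : Type*) [AddCommGroup M] [Module ℂ M] (n : ℕ) :
    ((⨂[ℂ]^n M) ⊗[ℂ] M) ≃ₗ[ℂ] ⨂[ℂ]^(n + 1) M :=
  (TensorProduct.congr (LinearEquiv.refl ℂ _) (pow1Equiv M).symm).trans
    TensorPower.mulEquiv

/-- The identification `M ⊗ (⨂^n M) ≃ ⨂^(n+1) M`. -/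
noncomputable def leftMulEquiv (M : Type*) [AddCommGroup M] [Module ℂ M] (n : ℕ) :
    (M ⊗[ℂ] (⨂[ℂ]^n M)) ≃ₗ[ℂ] ⨂[ℂ]^(n + 1) M :=
  ((TensorProduct.congr (pow1Equiv M).symm (LinearEquiv.refl ℂ _)).trans
    TensorPower.mulEquiv).trans (TensorPower.cast ℂ M (Nat.add_comm 1 n))

section Helpers

theorem map_range_mapIncl {V W V' W' : Type*} [AddCommGroup V] [Module ℂ V] [AddCommGroup W]
    [Module ℂ W] [AddCommGroup V'] [Module ℂ V'] [AddCommGroup W'] [Module ℂ W']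
    (a : V →ₗ[ℂ] V') (b : W →ₗ[ℂ] W') (K : Submodule ℂ V) (L : Submodule ℂ W) :
    Submodule.map (TensorProduct.map a b) (LinearMap.range (TensorProduct.mapIncl K L)) =
      LinearMap.range (TensorProduct.mapIncl (K.map a) (L.map b)) := by
  rw [TensorProduct.mapIncl, TensorProduct.mapIncl, TensorProduct.range_map,
    TensorProduct.range_map]
  simp only [Submodule.range_subtype]
  rw [Submodule.map_map₂, Submodule.map₂_map_map]
  rfl

theorem core_ker {V W B C C' D : Type*} [AddCommGroup V] [Module ℂ V] [AddCommGroup W]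
    [Module ℂ W] [AddCommGroup B] [Module ℂ B] [AddCommGroup C] [Module ℂ C]
    [AddCommGroup C'] [Module ℂ C'] [AddCommGroup D] [Module ℂ D]
    (m : W →ₗ[ℂ] B) (hm : Function.Surjective m)
    (f : (V ⊗[ℂ] B) →ₗ[ℂ] C) (g : (B ⊗[ℂ] V) →ₗ[ℂ] C') (h : ((V ⊗[ℂ] B) ⊗[ℂ] V) →ₗ[ℂ] D)
    (hk : LinearMap.ker h =
      LinearMap.range (TensorProduct.mapIncl (LinearMap.ker f) (⊤ : Submodule ℂ V)) ⊔
        Submodule.map (TensorProduct.assoc ℂ V B V).symm.toLinearMap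
          (LinearMap.range (TensorProduct.mapIncl (⊤ : Submodule ℂ V) (LinearMap.ker g)))) :
    LinearMap.ker (h ∘ₗ (TensorProduct.map (TensorProduct.map LinearMap.id m) LinearMap.id)) =
      LinearMap.range (TensorProduct.mapIncl
        (LinearMap.ker (f ∘ₗ TensorProduct.map LinearMap.id m)) (⊤ : Submodule ℂ V)) ⊔
        Submodule.map (TensorProduct.assoc ℂ V W V).symm.toLinearMap
          (LinearMap.range (TensorProduct.mapIncl (⊤ : Submodule ℂ V)
            (LinearMap.ker (g ∘ₗ TensorProduct.map m LinearMap.id)))) := by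
  have s1 : Function.Surjective (TensorProduct.map (LinearMap.id : V →ₗ[ℂ] V) m) :=
    TensorProduct.map_surjective Function.surjective_id hm
  have s2 : Function.Surjective (TensorProduct.map m (LinearMap.id : V →ₗ[ℂ] V)) :=
    TensorProduct.map_surjective hm Function.surjective_id
  set φ := TensorProduct.map (LinearMap.id : V →ₗ[ℂ] V) m with hφ
  set ψ := TensorProduct.map m (LinearMap.id : V →ₗ[ℂ] V) with hψ
  set φ3 := TensorProduct.map φ (LinearMap.id : V →ₗ[ℂ] V) with hφ3
  set S1 := LinearMap.range (TensorProduct.mapIncl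
        (LinearMap.ker (f ∘ₗ φ)) (⊤ : Submodule ℂ V)) with hS1
  set S2 := LinearMap.range (TensorProduct.mapIncl (⊤ : Submodule ℂ V)
            (LinearMap.ker (g ∘ₗ ψ))) with hS2
  have e1 : S1.map φ3 = LinearMap.range (TensorProduct.mapIncl (LinearMap.ker f) ⊤) := by
    rw [hS1, hφ3, map_range_mapIncl, LinearMap.ker_comp,
      Submodule.map_comap_eq_of_surjective s1, Submodule.map_id]
  have hcomm : φ3 ∘ₗ (TensorProduct.assoc ℂ V W V).symm.toLinearMap =
      (TensorProduct.assoc ℂ V B V).symm.toLinearMap ∘ₗ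
        TensorProduct.map LinearMap.id ψ := by
    apply TensorProduct.ext'
    intro v x
    induction x using TensorProduct.induction_on with
    | zero => simp
    | tmul w z => simp [hφ3, hφ, hψ]
    | add x y hx hy => rw [TensorProduct.tmul_add, map_add, map_add, hx, hy]
  have e2 : (S2.map (TensorProduct.assoc ℂ V W V).symm.toLinearMap).map φ3 =
      Submodule.map (TensorProduct.assoc ℂ V B V).symm.toLinearMap
        (LinearMap.range (TensorProduct.mapIncl (⊤ : Submodule ℂ V) (LinearMap.ker g))) := by
    rw [← Submodule.map_comp, hcomm, Submodule.map_comp, hS2, map_range_mapIncl,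
      LinearMap.ker_comp, Submodule.map_comap_eq_of_surjective s2, Submodule.map_id]
  have e3 : LinearMap.ker φ3 ≤ S1 := by
    have hex : Function.Exact (LinearMap.ker φ).subtype φ := LinearMap.exact_subtype_ker_map φ
    have := rTensor_exact V hex s1
    have h3 : φ3 = LinearMap.rTensor V φ := rfl
    rw [h3, LinearMap.exact_iff.mp this, LinearMap.rTensor, TensorProduct.range_map, hS1,
      TensorProduct.mapIncl, TensorProduct.range_map]
    simp only [Submodule.range_subtype, LinearMap.range_id]
    exact Submodule.map₂_le_map₂_left (LinearMap.ker_le_ker_comp _ _)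
  rw [LinearMap.ker_comp, hk, ← e1, ← e2, ← Submodule.map_sup, Submodule.comap_map_eq]
  exact sup_eq_left.mpr (e3.trans le_sup_left)

/-- Transport along an equality of degrees. -/
def castA (A : ℕ → Type*) [∀ t, AddCommGroup (A t)] [∀ t, Module ℂ (A t)] {s t : ℕ}
    (h : s = t) : A s ≃ₗ[ℂ] A t := by
  subst h
  exact LinearEquiv.refl ℂ _

variable (A : ℕ → Type*) [∀ t, AddCommGroup (A t)] [∀ t, Module ℂ (A t)]
variable (mul : ∀ s t : ℕ, A s →ₗ[ℂ] A t →ₗ[ℂ] A (s + t))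

theorem castA_rfl {s : ℕ} (h : s = s) (x : A s) : castA A h x = x := rfl

theorem castA_of_heq {s t : ℕ} (h : s = t) (x : A s) (y : A t) (hxy : HEq x y) :
    castA A h x = y := by
  subst h
  exact eq_of_heq hxy

theorem castA_castA {s t u : ℕ} (h : s = t) (h' : t = u) (x : A s) :
    castA A h' (castA A h x) = castA A (h.trans h') x := by
  subst h; subst h'; rfl

theorem mul_castA_left {s s' t : ℕ} (h : s = s') (x : A s) (z : A t) :
    mul s' t (castA A h x) z = castA A (by rw [h]) (mul s t x z) := by
  subst h; rfl

theorem gassoc (hassoc : GradedAssoc A mul) (r s t : ℕ) (x : A r) (y : A s) (z : A t) :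
    castA A (Nat.add_assoc r s t) (mul (r + s) t (mul r s x y) z) =
      mul r (s + t) x (mul s t y z) :=
  castA_of_heq A _ _ _ (hassoc r s t x y z)

theorem MPow_right (n : ℕ) (w : ⨂[ℂ]^(n + 1) (A 1)) (z : A 1) :
    MPow A mul (n + 1) (rightMulEquiv (A 1) (n + 1) (w ⊗ₜ z)) =
      mul (n + 1) 1 (MPow A mul n w) z := by
  simp [MPow, rightMulEquiv, M2]

theorem tp_cast_mul {M : Type*} [AddCommGroup M] [Module ℂ M] {i j : ℕ} (h : i = j)
    (x : ⨂[ℂ]^i M) (y : ⨂[ℂ]^1 M) :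
    (TensorPower.mulEquiv (TensorPower.cast ℂ M h x ⊗ₜ[ℂ] y) : ⨂[ℂ]^(j + 1) M) =
      TensorPower.cast ℂ M (by rw [h]) (TensorPower.mulEquiv (x ⊗ₜ[ℂ] y)) := by
  subst h
  simp

theorem left_right {M : Type*} [AddCommGroup M] [Module ℂ M] (n : ℕ) (v : M) (w : ⨂[ℂ]^n M)
    (z : M) :
    leftMulEquiv M (n + 1) (v ⊗ₜ rightMulEquiv M n (w ⊗ₜ z)) =
      rightMulEquiv M (n + 1) (leftMulEquiv M n (v ⊗ₜ w) ⊗ₜ z) := by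
  have h := TensorPower.mul_assoc (R := ℂ) ((pow1Equiv M).symm v) w ((pow1Equiv M).symm z)
  simp only [TensorPower.gMul_def] at h
  simp only [leftMulEquiv, rightMulEquiv, LinearEquiv.trans_apply, TensorProduct.congr_tmul,
    LinearEquiv.refl_apply]
  rw [← h, tp_cast_mul, TensorPower.cast_cast]

theorem left_zero {M : Type*} [AddCommGroup M] [Module ℂ M] (v z : M) :
    leftMulEquiv M 1 (v ⊗ₜ (pow1Equiv M).symm z) =
      rightMulEquiv M 1 ((pow1Equiv M).symm v ⊗ₜ z) := by
  simp [leftMulEquiv, rightMulEquiv]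

theorem MPow_left (hassoc : GradedAssoc A mul) (n : ℕ) (v : A 1) (w : ⨂[ℂ]^(n + 1) (A 1)) :
    MPow A mul (n + 1) (leftMulEquiv (A 1) (n + 1) (v ⊗ₜ w)) =
      castA A (Nat.add_comm 1 (n + 1)) (mul 1 (n + 1) v (MPow A mul n w)) := by
  induction n with
  | zero =>
    obtain ⟨z, rfl⟩ := (pow1Equiv (A 1)).symm.surjective w
    have := left_zero v z
    erw [this, MPow_right]
    simp only [MPow, LinearEquiv.coe_coe, LinearEquiv.apply_symm_apply]
    exact (castA_rfl A rfl _).symm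
  | succ n ih =>
    obtain ⟨x, rfl⟩ := (rightMulEquiv (A 1) (n + 1)).surjective w
    induction x using TensorProduct.induction_on with
    | zero => simp
    | add x y hx hy => simp only [map_add, TensorProduct.tmul_add, hx, hy]
    | tmul w z =>
      rw [left_right, MPow_right, MPow_right, ih, mul_castA_left, ← gassoc A mul hassoc,
        castA_castA]

theorem MPow_surj (h53 : Cond53 A mul) (n : ℕ) : Function.Surjective (MPow A mul n) := by
  induction n with
  | zero => exact (pow1Equiv (A 1)).surjective
  | succ n ih =>
    rw [MPow]
    simp only [LinearMap.coe_comp, LinearEquiv.coe_coe]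
    exact (h53 (n + 1) 1 (by omega) le_rfl).comp
      ((TensorProduct.map_surjective ih (pow1Equiv (A 1)).surjective).comp
        (LinearEquiv.surjective _))

theorem ker_eq_map {P Q C D : Type*} [AddCommGroup P] [Module ℂ P] [AddCommGroup Q] [Module ℂ Q]
    [AddCommGroup C] [Module ℂ C] [AddCommGroup D] [Module ℂ D] (e : P ≃ₗ[ℂ] Q) (c : C ≃ₗ[ℂ] D)
    (p : P →ₗ[ℂ] C) (q : Q →ₗ[ℂ] D) (h : ∀ x, q (e x) = c (p x)) :
    LinearMap.ker q = (LinearMap.ker p).map e.toLinearMap := by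
  ext y
  obtain ⟨x, rfl⟩ := e.surjective y
  simp [h]

theorem ker_left (hassoc : GradedAssoc A mul) (n : ℕ) : LinearMap.ker (MPow A mul (n + 1)) =
    (LinearMap.ker (M2 A mul 1 (n + 1) ∘ₗ TensorProduct.map LinearMap.id (MPow A mul n))).map
      (leftMulEquiv (A 1) (n + 1)).toLinearMap := by
  apply ker_eq_map _ (castA A (Nat.add_comm 1 (n + 1)))
  intro x
  induction x using TensorProduct.induction_on with
  | zero => simp
  | add x y hx hy => simp only [map_add, hx, hy]
  | tmul v w => rw [MPow_left A mul hassoc]; simp [M2]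

theorem ker_right (n : ℕ) : LinearMap.ker (MPow A mul (n + 1)) =
    (LinearMap.ker (M2 A mul (n + 1) 1 ∘ₗ TensorProduct.map (MPow A mul n) LinearMap.id)).map
      (rightMulEquiv (A 1) (n + 1)).toLinearMap := by
  apply ker_eq_map _ (LinearEquiv.refl ℂ _)
  intro x
  induction x using TensorProduct.induction_on with
  | zero => simp
  | add x y hx hy => simp only [map_add, hx, hy]
  | tmul v w => rw [MPow_right A mul]; simp [M2]

theorem ker_total (hassoc : GradedAssoc A mul) (n : ℕ) : LinearMap.ker (MPow A mul (n + 2)) =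
    (LinearMap.ker (M3 A mul 1 (n + 1) 1 ∘ₗ (TensorProduct.map
      (TensorProduct.map LinearMap.id (MPow A mul n)) LinearMap.id))).map
      ((TensorProduct.congr (leftMulEquiv (A 1) (n + 1)) (LinearEquiv.refl ℂ (A 1))).trans
        (rightMulEquiv (A 1) (n + 2))).toLinearMap := by
  apply ker_eq_map _ (castA A (by omega))
  intro x
  induction x using TensorProduct.induction_on with
  | zero => simp
  | add x y hx hy => simp only [map_add, hx, hy]
  | tmul y z =>
    induction y using TensorProduct.induction_on with
    | zero => simp
    | add x y hx hy => simp only [map_add, TensorProduct.add_tmul, hx, hy]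
    | tmul v w =>
      simp only [LinearEquiv.trans_apply, TensorProduct.congr_tmul, LinearEquiv.refl_apply]
      rw [MPow_right A mul, MPow_left A mul hassoc, mul_castA_left]
      simp [M3, M2]

end Helpers

theorem stmt_14 (A : ℕ → Type*) [∀ t, AddCommGroup (A t)] [∀ t, Module ℂ (A t)]
    (mul : ∀ s t : ℕ, A s →ₗ[ℂ] A t →ₗ[ℂ] A (s + t))
    (hassoc : GradedAssoc A mul) (h52 : Cond52 A mul) (h53 : Cond53 A mul) :
    -- `MPow A mul k` is the `(k+1)`-fold multiplication map `M^{(k+1)}`, so this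
    -- says `Ker M^{(n+1)} = (Ker M^{(n)}) ⊗ 𝒜_1 + 𝒜_1 ⊗ Ker M^{(n)}` for `n = 2, 3, …`.
    ∀ n : ℕ, 1 ≤ n →
      LinearMap.ker (MPow A mul (n + 1)) =
        Submodule.map (rightMulEquiv (A 1) (n + 1)).toLinearMap
          (LinearMap.range (TensorProduct.mapIncl (LinearMap.ker (MPow A mul n))
            (⊤ : Submodule ℂ (A 1)))) ⊔
        Submodule.map (leftMulEquiv (A 1) (n + 1)).toLinearMap
          (LinearMap.range (TensorProduct.mapIncl (⊤ : Submodule ℂ (A 1))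
            (LinearMap.ker (MPow A mul n)))) := by
  intro n hn
  obtain ⟨k, rfl⟩ : ∃ k, n = k + 1 := ⟨n - 1, by omega⟩
  have key := core_ker (MPow A mul k) (MPow_surj A mul h53 k) _ _ _
    (h52 1 (k + 1) 1 le_rfl (by omega) le_rfl)
  rw [ker_total A mul hassoc, key, Submodule.map_sup]
  congr 1
  · rw [ker_left A mul hassoc k]
    have := map_range_mapIncl (leftMulEquiv (A 1) (k + 1)).toLinearMap
      (LinearMap.id : A 1 →ₗ[ℂ] A 1)
      (LinearMap.ker (M2 A mul 1 (k + 1) ∘ₗ TensorProduct.map LinearMap.id (MPow A mul k))) ⊤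
    rw [Submodule.map_id] at this
    rw [← this, ← Submodule.map_comp]
    rfl
  · rw [ker_right A mul k]
    have := map_range_mapIncl (LinearMap.id : A 1 →ₗ[ℂ] A 1)
      (rightMulEquiv (A 1) (k + 1)).toLinearMap ⊤
      (LinearMap.ker (M2 A mul (k + 1) 1 ∘ₗ TensorProduct.map (MPow A mul k) LinearMap.id))
    rw [Submodule.map_id] at this
    rw [← this, ← Submodule.map_comp, ← Submodule.map_comp]
    congr 1
    apply TensorProduct.ext'
    intro v x
    induction x using TensorProduct.induction_on with
    | zero => simp
    | add x y hx hy => rw [TensorProduct.tmul_add, map_add, map_add, hx, hy]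
    | tmul w z => simp [left_right]
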